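/- arXiv:1511.00139 — 6 statements merged into one kernel-verified Lean document; each statement's English description precedes it below -/
import Mathlib

section
/- The protein folding map G : X → X is continuous with respect to the metric d. -/
open scoped BigOperators

/-- Absolute-encoding conformations of a protein with `N+1` residues:
maps `{1,…,N} → {1,2,3,4}`, encoded with `Fin N → Fin 4`
(index `j : Fin N` is residue `j+1`, value `v : Fin 4` is direction `v+1`). -/
abbrev Conformation (N : ℕ) := Fin N → Fin 4

/-- A single fold instruction: an integer `k` with `|k| ≤ N`. -/
abbrev FoldVal (N : ℕ) := {k : ℤ // |k| ≤ (N : ℤ)}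

/-- Folding sequences `F : ℕ → [−N, N] ∩ ℤ`. -/
abbrev FoldSeq (N : ℕ) := ℕ → FoldVal N

/-- The phase space `𝒳` of the 2D HP protein folding process. -/
abbrev PhaseSpace (N : ℕ) := Conformation N × FoldSeq N

/-- Distance between conformations: `d_C(C,C') = Σ_{k=1}^N δ(C_k,C'_k)·2^{N−k}`. -/
noncomputable def dC (N : ℕ) (C C' : Conformation N) : ℝ :=
  ∑ k : Fin N, (if C k = C' k then 0 else 1) * 2 ^ (N - ((k : ℕ) + 1))

/-- Distance between folding sequences:
`d_F(F,F') = (9/(2N))·Σ_{k=0}^∞ |F(k) − F'(k)|/10^{k+1}`. -/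
noncomputable def dF (N : ℕ) (F F' : FoldSeq N) : ℝ :=
  ((9 : ℝ) / (2 * N)) * ∑' k : ℕ, |((F k : ℤ) : ℝ) - ((F' k : ℤ) : ℝ)| / 10 ^ (k + 1)

/-- The distance on the phase space: `d((C,F),(C',F')) = d_C(C,C') + d_F(F,F')`. -/
noncomputable def dX (N : ℕ) (X Y : PhaseSpace N) : ℝ :=
  dC N X.1 Y.1 + dF N X.2 Y.2

/-- The clockwise fold function `f : 1↦4, 2↦3, 3↦1, 4↦2` (0-indexed: `0↦3, 1↦2, 2↦0, 3↦1`). -/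
def foldClockwise : Fin 4 → Fin 4 := ![3, 2, 0, 1]

/-- The anticlockwise fold function `f⁻¹ : 4↦1, 3↦2, 1↦3, 2↦4`
(0-indexed: `0↦2, 1↦3, 2↦1, 3↦0`). -/
def foldAnticlockwise : Fin 4 → Fin 4 := ![2, 3, 1, 0]

/-- `f^{sign(k)}`: the clockwise fold if `k > 0`, the anticlockwise fold if `k < 0`,
the identity if `k = 0`. -/
def foldPow (k : ℤ) : Fin 4 → Fin 4 :=
  if 0 < k then foldClockwise else if k < 0 then foldAnticlockwise else id

/-- The map `f_k`, acting on a conformation by applying `f^{sign(k)}` to every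
coordinate `≥ |k|` (1-based) and keeping the coordinates `< |k|` unchanged. -/
def foldMap (N : ℕ) (k : ℤ) (C : Conformation N) : Conformation N :=
  fun j => if (((j : ℕ) + 1 : ℤ)) < |k| then C j else foldPow k (C j)

/-- The protein folding map `G(C,F) = (f_{i(F)}(C), σ(F))` where `i(F) = F(0)`
and `σ` is the shift. -/
def G (N : ℕ) (X : PhaseSpace N) : PhaseSpace N :=
  (foldMap N (X.2 0).1 X.1, fun n => X.2 (n + 1))

/-- The fold instruction `0` (no fold). -/
def zeroFold (N : ℕ) : FoldVal N := ⟨0, by simp⟩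

/-- `U ⊆ 𝒳` is open for the metric `d`. -/
def IsOpenD (N : ℕ) (U : Set (PhaseSpace N)) : Prop :=
  ∀ x ∈ U, ∃ ε > 0, ∀ y, dX N x y < ε → y ∈ U

theorem summable_aux (N : ℕ) (F F' : FoldSeq N) :
    Summable (fun k : ℕ => |((F k : ℤ) : ℝ) - ((F' k : ℤ) : ℝ)| / 10 ^ (k + 1)) := by
  have hg : Summable (fun k : ℕ => (2 * N : ℝ) * (1 / 10 : ℝ) ^ k) :=
    (summable_geometric_of_lt_one (by norm_num) (by norm_num)).mul_left _
  refine Summable.of_nonneg_of_le (fun k => by positivity) (fun k => ?_) hg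
  have h1 : |((F k : ℤ) : ℝ)| ≤ N := by exact_mod_cast (F k).2
  have h2 : |((F' k : ℤ) : ℝ)| ≤ N := by exact_mod_cast (F' k).2
  have h3 : |((F k : ℤ) : ℝ) - ((F' k : ℤ) : ℝ)| ≤ 2 * N := by
    rw [abs_le] at *
    constructor <;> linarith [h1.1, h1.2, h2.1, h2.2]
  rw [one_div, inv_pow, ← div_eq_mul_inv]
  gcongr
  · norm_num
  · omega

theorem dF_nonneg (N : ℕ) (F F' : FoldSeq N) : 0 ≤ dF N F F' :=
  mul_nonneg (by positivity) (tsum_nonneg (fun k => by positivity))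

theorem dC_nonneg (N : ℕ) (C C' : Conformation N) : 0 ≤ dC N C C' :=
  Finset.sum_nonneg (fun k _ => by split_ifs <;> positivity)

theorem dC_self (N : ℕ) (C : Conformation N) : dC N C C = 0 := by
  simp [dC]

theorem eq_of_dC_lt (N : ℕ) (C C' : Conformation N) (h : dC N C C' < 1) : C = C' := by
  by_contra hne
  obtain ⟨k, hk⟩ := Function.ne_iff.mp hne
  have h1 := Finset.single_le_sum
    (f := fun k : Fin N => ((if C k = C' k then 0 else 1) * 2 ^ (N - ((k : ℕ) + 1)) : ℝ))
    (fun k _ => by split_ifs <;> positivity) (Finset.mem_univ k)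
  simp only [hk, if_false, one_mul] at h1
  have h2 : (1 : ℝ) ≤ 2 ^ (N - ((k : ℕ) + 1)) := one_le_pow₀ (by norm_num)
  unfold dC at h
  linarith

theorem dF_shift (N : ℕ) (F F' : FoldSeq N) :
    dF N F F' = (9 / (2 * N) : ℝ) * (|((F 0 : ℤ) : ℝ) - ((F' 0 : ℤ) : ℝ)| / 10) +
      dF N (fun n => F (n + 1)) (fun n => F' (n + 1)) / 10 := by
  unfold dF
  rw [(summable_aux N F F').tsum_eq_zero_add, mul_add, mul_div_assoc, ← tsum_div_const]
  congr 2
  · norm_num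
  · refine tsum_congr fun k => ?_
    rw [div_div, ← pow_succ]

/-- the protein folding map `G : 𝒳 → 𝒳` is continuous with respect to
the metric `d`. -/
theorem G_continuous (N : ℕ) (hN : 1 ≤ N) :
    ∀ X : PhaseSpace N, ∀ ε : ℝ, 0 < ε → ∃ δ : ℝ, 0 < δ ∧
      ∀ Y : PhaseSpace N, dX N X Y < δ → dX N (G N X) (G N Y) < ε := by
  intro X ε hε
  have hN' : (0 : ℝ) < N := by exact_mod_cast hN
  have hc : (0 : ℝ) < 9 / (2 * N) := by positivity
  refine ⟨min 1 (min (9 / (2 * N) / 10) (ε / 10)), by positivity, fun Y h => ?_⟩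
  obtain ⟨C, F⟩ := X
  obtain ⟨C', F'⟩ := Y
  simp only [dX, lt_min_iff] at h
  obtain ⟨h1, h2, h3⟩ := h
  have a1 := dF_nonneg N F F'
  have a2 := dC_nonneg N C C'
  have a3 := dF_nonneg N (fun n => F (n + 1)) (fun n => F' (n + 1))
  have a4 := dF_shift N F F'
  have hC : C = C' := eq_of_dC_lt N C C' (by linarith)
  have hF : F 0 = F' 0 := by
    by_contra hne
    have hz : (F 0 : ℤ) - (F' 0 : ℤ) ≠ 0 := fun h => hne (Subtype.ext (sub_eq_zero.mp h))
    have h5 : (1 : ℝ) ≤ |((F 0 : ℤ) : ℝ) - ((F' 0 : ℤ) : ℝ)| := by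
      exact_mod_cast Int.one_le_abs hz
    have h6 := mul_le_mul_of_nonneg_left h5 hc.le
    linarith
  subst hC
  simp only [dX, G, ← hF, dC_self]
  have h7 : 0 ≤ (9 / (2 * N) : ℝ) * (|((F 0 : ℤ) : ℝ) - ((F' 0 : ℤ) : ℝ)| / 10) := by positivity
  linarith
end

section
/- The protein folding map G is regular: the set of periodic points of G (points X with G^n(X) = X for some n ≥ 1) is dense in the metric space (X, d); that is, for every X ∈ X and every ε > 0 there exists a periodic point X̃ of G with d(X, X̃) < ε. -/
open scoped BigOperators

lemma foldPow_injective (k : ℤ) : Function.Injective (foldPow k) := by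
  unfold foldPow
  split_ifs
  · unfold foldClockwise; decide
  · unfold foldAnticlockwise; decide
  · exact Function.injective_id

lemma foldMap_injective (N : ℕ) (k : ℤ) : Function.Injective (foldMap N k) := by
  intro C D h
  funext j
  have hj := congrFun h j
  unfold foldMap at hj
  split_ifs at hj
  · exact hj
  · exact foldPow_injective k hj

lemma G_iterate (N : ℕ) (n : ℕ) : ∀ F : FoldSeq N, ∃ P : Conformation N → Conformation N,
    Function.Injective P ∧ ∀ C, (G N)^[n] (C, F) = (P C, fun k => F (k + n)) := by
  induction n with
  | zero => exact fun F => ⟨id, Function.injective_id, fun C => rfl⟩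
  | succ n ih =>
    intro F
    obtain ⟨P, hP, h⟩ := ih (fun k => F (k + 1))
    refine ⟨fun C => P (foldMap N (F 0).1 C), hP.comp (foldMap_injective N _), fun C => ?_⟩
    rw [Function.iterate_succ_apply]
    show (G N)^[n] (foldMap N (F 0).1 C, fun k => F (k + 1)) = _
    rw [h]
    rfl

lemma dF_le (N : ℕ) (hN : 1 ≤ N) (F F' : FoldSeq N) (m : ℕ) (h : ∀ k < m, F k = F' k) :
    dF N F F' ≤ (1 / 10) ^ m := by
  have hN' : (0 : ℝ) < N := by exact_mod_cast hN
  set a : ℕ → ℝ := fun k => |((F k : ℤ) : ℝ) - ((F' k : ℤ) : ℝ)| / 10 ^ (k + 1) with ha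
  have hb : ∀ G : FoldVal N, |((G : ℤ) : ℝ)| ≤ N := fun G => by exact_mod_cast G.2
  have hle : ∀ k, a k ≤ (2 * N / 10) * (1 / 10) ^ k := by
    intro k
    have h1 : |((F k : ℤ) : ℝ) - ((F' k : ℤ) : ℝ)| ≤ 2 * N := by
      have := abs_sub ((F k : ℤ) : ℝ) ((F' k : ℤ) : ℝ)
      linarith [hb (F k), hb (F' k)]
    calc a k ≤ 2 * N / 10 ^ (k + 1) := by simp only [ha]; gcongr
      _ = _ := by rw [one_div, inv_pow, pow_succ]; field_simp
  have hg : Summable (fun k : ℕ => (1 / 10 : ℝ) ^ k) :=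
    summable_geometric_of_lt_one (by norm_num) (by norm_num)
  have hs : Summable a := Summable.of_nonneg_of_le (fun k => by simp only [ha]; positivity) hle
    (hg.mul_left _)
  have h0 : ∑ k ∈ Finset.range m, a k = 0 := by
    apply Finset.sum_eq_zero
    intro k hk
    simp [ha, h k (Finset.mem_range.mp hk)]
  have h2 : ∑' k, a k ≤ (2 * N / 10) * (1 / 10) ^ m * (10 / 9) := by
    rw [← hs.sum_add_tsum_nat_add m, h0, zero_add]
    have hgs : ∑' k : ℕ, (2 * N / 10 : ℝ) * (1 / 10) ^ m * (1 / 10) ^ k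
        = (2 * N / 10) * (1 / 10) ^ m * (10 / 9) := by
      rw [tsum_mul_left, tsum_geometric_of_lt_one (by norm_num) (by norm_num)]
      norm_num
    rw [← hgs]
    refine Summable.tsum_le_tsum (fun k => ?_) ((summable_nat_add_iff m).2 hs) (hg.mul_left _)
    refine (hle (k + m)).trans (le_of_eq ?_)
    rw [pow_add]; ring
  calc dF N F F' = (9 / (2 * N)) * ∑' k, a k := rfl
    _ ≤ (9 / (2 * N)) * ((2 * N / 10) * (1 / 10) ^ m * (10 / 9)) := by gcongr
    _ = (1 / 10) ^ m := by field_simp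

/-- the protein folding map `G` is regular: its periodic points are
dense in `(𝒳, d)`. -/
theorem folding_regular (N : ℕ) (hN : 1 ≤ N) :
    ∀ X : PhaseSpace N, ∀ ε : ℝ, 0 < ε →
      ∃ X' : PhaseSpace N, (∃ n : ℕ, 1 ≤ n ∧ (G N)^[n] X' = X') ∧ dX N X X' < ε := by
  rintro ⟨C, F⟩ ε hε
  obtain ⟨m, hm⟩ := exists_pow_lt_of_lt_one hε (show (1 / 10 : ℝ) < 1 by norm_num)
  set F' : FoldSeq N := fun k => F (k % (m + 1)) with hF'
  refine ⟨(C, F'), ?_, ?_⟩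
  · obtain ⟨P, hP, h⟩ := G_iterate N (m + 1) F'
    have hper : (fun k => F' (k + (m + 1))) = F' := by
      funext k
      simp [hF']
    rw [hper] at h
    have hit : ∀ r : ℕ, ∀ D, ((G N)^[m + 1])^[r] (D, F') = (P^[r] D, F') := by
      intro r
      induction r with
      | zero => exact fun D => rfl
      | succ r ih =>
        intro D
        rw [Function.iterate_succ_apply, h, ih, Function.iterate_succ_apply]
    obtain ⟨r, hr, hr'⟩ := hP.mem_periodicPts C
    refine ⟨(m + 1) * r, Nat.mul_pos (Nat.succ_pos m) hr, ?_⟩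
    rw [Function.iterate_mul, hit, hr'.eq]
  · have h1 : dC N C C = 0 := by simp [dC]
    have h2 := dF_le N hN F F' m (fun k hk => by
      simp only [hF']
      rw [Nat.mod_eq_of_lt (by omega)])
    show dC N C C + dF N F F' < ε
    linarith
end

section
/- The protein folding map G is strongly transitive: for all points X_A, X_B ∈ X and every ε > 0 there exist a point X ∈ X with d(X, X_A) ≤ ε and an integer n ≥ 1 such that G^n(X) = X_B. -/
open scoped BigOperators

def Reach (N : ℕ) (C D : Conformation N) : Prop :=
  ∀ F : FoldSeq N, ∃ (F' : FoldSeq N) (n : ℕ), (G N)^[n] (C, F') = (D, F)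

theorem Reach.trans {N : ℕ} {C D E : Conformation N} (h : Reach N C D) (h' : Reach N D E) :
    Reach N C E := by
  intro F
  obtain ⟨F1, n1, h1⟩ := h' F
  obtain ⟨F2, n2, h2⟩ := h F1
  exact ⟨F2, n1 + n2, by rw [Function.iterate_add_apply, h2, h1]⟩

theorem Reach.refl {N : ℕ} (C : Conformation N) : Reach N C C := fun F => ⟨F, 0, rfl⟩

theorem reach_step {N : ℕ} (k : FoldVal N) (C : Conformation N) :
    Reach N C (foldMap N k.1 C) := by
  intro F
  exact ⟨fun n => Nat.casesOn n k F, 1, rfl⟩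

theorem reach_iter {N : ℕ} (k : FoldVal N) (C : Conformation N) (t : ℕ) :
    Reach N C ((foldMap N k.1)^[t] C) := by
  induction t with
  | zero => exact Reach.refl C
  | succ t ih =>
    rw [Function.iterate_succ_apply']
    exact ih.trans (reach_step k _)

theorem iter_coord {N : ℕ} (k : ℤ) (hk : 0 < k) (C : Conformation N) (t : ℕ) (i : Fin N) :
    ((foldMap N k)^[t] C) i =
      if ((i : ℕ) + 1 : ℤ) < k then C i else foldClockwise^[t] (C i) := by
  induction t with
  | zero => simp
  | succ t ih =>
    rw [Function.iterate_succ_apply', Function.iterate_succ_apply']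
    unfold foldMap at ih ⊢
    rw [ih, abs_of_pos hk]
    by_cases h : ((i : ℕ) + 1 : ℤ) < k
    · simp [h]
    · simp [h, foldPow, hk]

theorem clockwise_trans (a b : Fin 4) : ∃ t : ℕ, foldClockwise^[t] a = b := by
  have : ∀ a b : Fin 4, ∃ t : Fin 4, foldClockwise^[(t : ℕ)] a = b := by decide
  obtain ⟨t, ht⟩ := this a b
  exact ⟨t, ht⟩

theorem reach_aux {N : ℕ} (D : Conformation N) (k : ℕ) : ∀ C : Conformation N,
    (∀ i : Fin N, (i : ℕ) + k < N → C i = D i) → Reach N C D := by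
  induction k with
  | zero =>
    intro C h
    have : C = D := funext fun i => h i (by simp)
    rw [this]
    exact Reach.refl D
  | succ k ih =>
    intro C h
    by_cases hk : N ≤ k
    · exact ih C fun i hi => by omega
    · push Not at hk
      let j : Fin N := ⟨N - 1 - k, by omega⟩
      obtain ⟨t, ht⟩ := clockwise_trans (C j) (D j)
      have hb : |((N : ℤ) - k)| ≤ (N : ℤ) := by rw [abs_le]; constructor <;> omega
      refine (reach_iter ⟨(N : ℤ) - k, hb⟩ C t).trans (ih _ ?_)
      intro i hi
      rw [iter_coord ((N : ℤ) - k) (by omega)]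
      split_ifs with hlt
      · exact h i (by omega)
      · have : i = j := by
          apply Fin.ext
          show (i : ℕ) = N - 1 - k
          omega
        rw [this, ht]

theorem reach_all {N : ℕ} (C D : Conformation N) : Reach N C D :=
  reach_aux D N C fun i hi => by omega

theorem prefix_lemma {N : ℕ} (m : ℕ) : ∀ (C : Conformation N) (F : FoldSeq N),
    ∃ C' : Conformation N, ∀ F' : FoldSeq N, ∃ F'' : FoldSeq N,
      (∀ k < m, F'' k = F k) ∧ (G N)^[m] (C, F'') = (C', F') := by
  induction m with
  | zero => exact fun C F => ⟨C, fun F' => ⟨F', by simp, rfl⟩⟩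
  | succ m ih =>
    intro C F
    obtain ⟨C', h⟩ := ih (foldMap N (F 0).1 C) (fun n => F (n + 1))
    refine ⟨C', fun F' => ?_⟩
    obtain ⟨F'', h1, h2⟩ := h F'
    refine ⟨fun n => Nat.casesOn n (F 0) F'', ?_, ?_⟩
    · intro k hk
      cases k with
      | zero => rfl
      | succ k => exact h1 k (by omega)
    · rw [Function.iterate_succ_apply]
      exact h2

theorem dF_small (N : ℕ) (ε : ℝ) (hε : 0 < ε) : ∃ m : ℕ, 1 ≤ m ∧
    ∀ F F' : FoldSeq N, (∀ k < m, F k = F' k) → dF N F F' ≤ ε := by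
  let g : ℕ → ℝ := fun k => 2 * N / 10 ^ (k + 1)
  have hg : Summable g := by
    have h := (summable_geometric_of_lt_one (r := (1 / 10 : ℝ)) (by norm_num)
      (by norm_num)).mul_left (2 * N / 10 : ℝ)
    refine h.congr fun k => ?_
    simp only [g, one_div, inv_pow, pow_succ]
    field_simp
  have hlim := (tendsto_sum_nat_add g).const_mul ((9 : ℝ) / (2 * N))
  rw [mul_zero] at hlim
  obtain ⟨m, hm, hm1⟩ := ((hlim.eventually (gt_mem_nhds hε)).and
    (Filter.eventually_ge_atTop 1)).exists
  refine ⟨m, hm1, fun F F' h => le_trans ?_ hm.le⟩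
  unfold dF
  refine mul_le_mul_of_nonneg_left ?_ (by positivity)
  have hle : ∀ k, |((F k : ℤ) : ℝ) - ((F' k : ℤ) : ℝ)| / 10 ^ (k + 1) ≤ g k := by
    intro k
    refine div_le_div_of_nonneg_right ?_ (by positivity)
    have h1 : |((F k : ℤ) : ℝ)| ≤ N := by exact_mod_cast (F k).2
    have h2 : |((F' k : ℤ) : ℝ)| ≤ N := by exact_mod_cast (F' k).2
    have h3 := abs_sub ((F k : ℤ) : ℝ) ((F' k : ℤ) : ℝ)
    linarith
  have hs : Summable fun k : ℕ => |((F k : ℤ) : ℝ) - ((F' k : ℤ) : ℝ)| / 10 ^ (k + 1) :=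
    Summable.of_nonneg_of_le (fun k => by positivity) hle hg
  rw [← hs.sum_add_tsum_nat_add m, Finset.sum_eq_zero, zero_add]
  · exact Summable.tsum_le_tsum (fun k => hle (k + m)) ((summable_nat_add_iff m).2 hs)
      ((summable_nat_add_iff m).2 hg)
  · intro k hk
    rw [h k (Finset.mem_range.1 hk)]
    simp

/-- the protein folding map `G` is strongly transitive: for all
`X_A, X_B ∈ 𝒳` and `ε > 0` there are `X` with `d(X, X_A) ≤ ε` and `n ≥ 1` with
`G^n(X) = X_B`. -/
theorem folding_strongly_transitive (N : ℕ) (hN : 1 ≤ N) :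
    ∀ XA XB : PhaseSpace N, ∀ ε : ℝ, 0 < ε →
      ∃ X : PhaseSpace N, ∃ n : ℕ, 1 ≤ n ∧ dX N X XA ≤ ε ∧ (G N)^[n] X = XB := by
  rintro ⟨CA, FA⟩ ⟨CB, FB⟩ ε hε
  obtain ⟨m, hm1, hm⟩ := dF_small N ε hε
  obtain ⟨C', hC'⟩ := prefix_lemma m CA FA
  obtain ⟨F', n, hn⟩ := reach_all C' CB FB
  obtain ⟨F'', h1, h2⟩ := hC' F'
  refine ⟨(CA, F''), n + m, by omega, ?_, ?_⟩
  · have := hm F'' FA h1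
    simpa [dX, dC] using this
  · rw [Function.iterate_add_apply, h2, hn]
end

section
/- The protein folding map G has sensitive dependence on initial conditions: there exists δ > 0 such that for every X ∈ X and every ε > 0 there exist Y ∈ X with d(X,Y) < ε and n ∈ ℕ with d(G^n(X), G^n(Y)) > δ. -/
open scoped BigOperators

theorem iterate_snd (N : ℕ) (n : ℕ) : ∀ (X : PhaseSpace N) (k : ℕ),
    ((G N)^[n] X).2 k = X.2 (k + n) := by
  induction n with
  | zero => intro X k; rfl
  | succ n ih =>
    intro X k
    rw [Function.iterate_succ_apply, ih]
    rfl

theorem dF_single (N : ℕ) (F F' : FoldSeq N) (m : ℕ) (h : ∀ k, k ≠ m → F' k = F k) :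
    dF N F F' = ((9 : ℝ) / (2 * N)) * (|((F m : ℤ) : ℝ) - ((F' m : ℤ) : ℝ)| / 10 ^ (m + 1)) := by
  unfold dF
  rw [tsum_eq_single m]
  intro k hk
  simp [h k hk]

theorem exists_other (N : ℕ) (hN : 1 ≤ N) (a : FoldVal N) :
    ∃ b : FoldVal N, 1 ≤ |(a : ℤ) - (b : ℤ)| ∧ |(a : ℤ) - (b : ℤ)| ≤ N := by
  obtain ⟨a, ha⟩ := a
  by_cases h : a = 0
  · refine ⟨⟨1, by simp; omega⟩, ?_⟩
    subst h
    simp; omega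
  · refine ⟨⟨0, by simp⟩, ?_⟩
    simp only [sub_zero]
    exact ⟨Int.one_le_abs h, ha⟩

/-- the protein folding map `G` has sensitive dependence on initial
conditions: there is `δ > 0` such that for every `X` and every `ε > 0` there are `Y`
with `d(X,Y) < ε` and `n ∈ ℕ` with `d(G^n(X), G^n(Y)) > δ`. -/
theorem folding_sensitive (N : ℕ) (hN : 1 ≤ N) :
    ∃ δ : ℝ, 0 < δ ∧ ∀ X : PhaseSpace N, ∀ ε : ℝ, 0 < ε →
      ∃ Y : PhaseSpace N, ∃ n : ℕ,
        dX N X Y < ε ∧ δ < dX N ((G N)^[n] X) ((G N)^[n] Y) := by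
  have hN' : (0 : ℝ) < N := by exact_mod_cast hN
  refine ⟨9 / (2 * N) * (1 / 20), by positivity, ?_⟩
  rintro ⟨C, F⟩ ε hε
  obtain ⟨m, hm⟩ := exists_pow_lt_of_lt_one (show 0 < ε / 9 by positivity)
    (show (1 / 10 : ℝ) < 1 by norm_num)
  obtain ⟨b, hb1, hb2⟩ := exists_other N hN (F m)
  have hb1' : (1 : ℝ) ≤ |((F m : ℤ) : ℝ) - ((b : ℤ) : ℝ)| := by exact_mod_cast hb1
  have hb2' : |((F m : ℤ) : ℝ) - ((b : ℤ) : ℝ)| ≤ N := by exact_mod_cast hb2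
  have hc : (0 : ℝ) < 9 / (2 * N) := by positivity
  refine ⟨(C, Function.update F m b), m, ?_, ?_⟩
  · unfold dX
    rw [dC_self, zero_add, dF_single N _ _ m (fun k hk => by simp [hk])]
    simp only [Function.update_self]
    calc _ ≤ (9 : ℝ) / (2 * N) * (N / 10 ^ (m + 1)) := by gcongr
      _ = 9 / 20 * (1 / 10) ^ m := by
        rw [one_div, inv_pow]; field_simp; ring
      _ < ε := by
        have : (0 : ℝ) < (1 / 10) ^ m := by positivity
        linarith
  · unfold dX
    have h0 := dC_nonneg N ((G N)^[m] (C, F)).1 ((G N)^[m] (C, Function.update F m b)).1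
    rw [dF_single N _ _ 0 (fun k hk => by simp [iterate_snd, hk])]
    simp only [iterate_snd, zero_add, Function.update_self, pow_one]
    have : (9 : ℝ) / (2 * N) * (1 / 20)
        < 9 / (2 * N) * (|((F m : ℤ) : ℝ) - ((b : ℤ) : ℝ)| / 10) := by
      apply mul_lt_mul_of_pos_left _ hc
      linarith
    linarith
end

section
/- The chaotic-iterations map G̃_f is continuous on the metric space (X̃, d). -/
open scoped BigOperators

/-- Boolean states of a system with `N` cells: `{0,1}^N`. -/
abbrev BState (N : ℕ) := Fin N → Bool

/-- Strategies: maps `S : ℕ → {1,…,N}` (encoded with `Fin N`). -/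
abbrev Strategy (N : ℕ) := ℕ → Fin N

/-- The phase space `𝒳̃` of chaotic iterations: strategies × boolean states. -/
abbrev CISpace (N : ℕ) := Strategy N × BState N

/-- `F_f(k,E)` agrees with `E` on every `j ≠ k` and equals `f(E)_k` at `k`. -/
def Ff {N : ℕ} (f : BState N → BState N) (k : Fin N) (E : BState N) : BState N :=
  fun j => if j = k then f E k else E j

/-- The chaotic-iterations map `G̃_f(S,E) = (σ(S), F_f(i(S),E))`, where `i(S) = S(0)`
and `σ` is the shift on strategies. -/
def Gf {N : ℕ} (f : BState N → BState N) (X : CISpace N) : CISpace N :=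
  (fun n => X.1 (n + 1), Ff f (X.1 0) X.2)

/-- The distance on `𝒳̃`:
`d((S,E),(Ŝ,Ê)) = Σ_{k=1}^N δ(E_k,Ê_k) + (9/N)·Σ_{k=0}^∞ |S(k) − Ŝ(k)|/10^{k+1}`. -/
noncomputable def dCI {N : ℕ} (X Y : CISpace N) : ℝ :=
  (∑ k : Fin N, if X.2 k = Y.2 k then (0 : ℝ) else 1) +
    ((9 : ℝ) / N) * ∑' k : ℕ, |((X.1 k : ℕ) : ℝ) - ((Y.1 k : ℕ) : ℝ)| / 10 ^ (k + 1)

/-- `U ⊆ 𝒳̃` is open for the metric `d`. -/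
def IsOpenCI {N : ℕ} (U : Set (CISpace N)) : Prop :=
  ∀ x ∈ U, ∃ ε > 0, ∀ y, dCI x y < ε → y ∈ U

/-- `N(i,x)`: the state `x` with its `i`-th component negated. -/
def negComp {N : ℕ} (i : Fin N) (x : BState N) : BState N :=
  Function.update x i (!x i)

/-- Arcs of the iteration graph `Γ(f)`: an arc labeled `i` from `x` to `N(i,x)` iff
`F_f(i,x) = N(i,x)`. -/
def arc {N : ℕ} (f : BState N → BState N) (x y : BState N) : Prop :=
  ∃ i : Fin N, y = negComp i x ∧ Ff f i x = negComp i x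

/-- The iteration graph `Γ(f)` is strongly connected: every vertex is reachable
from every vertex by a directed path of arcs. -/
def GammaStronglyConnected {N : ℕ} (f : BState N → BState N) : Prop :=
  ∀ x y : BState N, Relation.ReflTransGen (arc f) x y

/-- `G̃_f` is chaotic according to Devaney on `(𝒳̃, d)`: its periodic points are
dense, and it is topologically transitive. -/
def DevaneyChaoticCI {N : ℕ} (f : BState N → BState N) : Prop :=
  (∀ X : CISpace N, ∀ ε : ℝ, 0 < ε →
      ∃ X' : CISpace N, (∃ n : ℕ, 1 ≤ n ∧ (Gf f)^[n] X' = X') ∧ dCI X X' < ε) ∧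
  (∀ U V : Set (CISpace N), IsOpenCI U → IsOpenCI V → U.Nonempty → V.Nonempty →
      ∃ k : ℕ, 1 ≤ k ∧ ((Gf f)^[k] '' U ∩ V).Nonempty)

/-- the chaotic-iterations map `G̃_f` is continuous on the metric
space `(𝒳̃, d)`. -/
theorem Gf_continuous (N : ℕ) (hN : 1 ≤ N) (f : BState N → BState N) :
    ∀ X : CISpace N, ∀ ε : ℝ, 0 < ε → ∃ δ : ℝ, 0 < δ ∧
      ∀ Y : CISpace N, dCI X Y < δ → dCI (Gf f X) (Gf f Y) < ε := by
  intro X ε hε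
  have hN0 : (0 : ℝ) < N := by exact_mod_cast hN
  have hc : (0 : ℝ) < 9 / N := by positivity
  refine ⟨min (min 1 (9 / N / 10)) (ε / 10), by positivity, ?_⟩
  intro Y hY
  have h1 : dCI X Y < 1 := lt_of_lt_of_le hY ((min_le_left _ _).trans (min_le_left _ _))
  have h2 : dCI X Y < 9 / N / 10 :=
    lt_of_lt_of_le hY ((min_le_left _ _).trans (min_le_right _ _))
  have h3 : dCI X Y < ε / 10 := lt_of_lt_of_le hY (min_le_right _ _)
  clear hY
  set a : ℕ → ℝ := fun k => |((X.1 k : ℕ) : ℝ) - ((Y.1 k : ℕ) : ℝ)| / 10 ^ (k + 1) with ha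
  have ha0 : ∀ k, 0 ≤ a k := fun k => by simp only [ha]; positivity
  have hsum : Summable a := by
    have hg : Summable (fun k : ℕ => (N : ℝ) * (1 / 10 : ℝ) ^ k) :=
      (summable_geometric_of_lt_one (by norm_num) (by norm_num)).mul_left _
    refine Summable.of_nonneg_of_le ha0 (fun k => ?_) hg
    have hx : ((X.1 k : ℕ) : ℝ) ≤ N := by exact_mod_cast (X.1 k).2.le
    have hy : ((Y.1 k : ℕ) : ℝ) ≤ N := by exact_mod_cast (Y.1 k).2.le
    have hx0 : (0 : ℝ) ≤ ((X.1 k : ℕ) : ℝ) := Nat.cast_nonneg _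
    have hy0 : (0 : ℝ) ≤ ((Y.1 k : ℕ) : ℝ) := Nat.cast_nonneg _
    have hab : |((X.1 k : ℕ) : ℝ) - ((Y.1 k : ℕ) : ℝ)| ≤ N :=
      abs_le.2 ⟨by linarith, by linarith⟩
    simp only [ha]
    rw [one_div, inv_pow, ← div_eq_mul_inv]
    gcongr
    · norm_num
    · omega
  have hd : dCI X Y = (∑ k : Fin N, if X.2 k = Y.2 k then (0 : ℝ) else 1) +
      ((9 : ℝ) / N) * ∑' k : ℕ, a k := rfl
  have hH : ∀ k ∈ (Finset.univ : Finset (Fin N)),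
      (0 : ℝ) ≤ if X.2 k = Y.2 k then (0 : ℝ) else 1 := by
    intro k _
    split_ifs <;> norm_num
  have hHs := Finset.sum_nonneg hH
  have hT : 0 ≤ ∑' k, a k := tsum_nonneg ha0
  have hT' : 0 ≤ ((9 : ℝ) / N) * ∑' k : ℕ, a k := by positivity
  have hE : X.2 = Y.2 := by
    funext k
    by_contra hne
    have := Finset.single_le_sum hH (Finset.mem_univ k)
    rw [if_neg hne] at this
    linarith
  have hS : X.1 0 = Y.1 0 := by
    by_contra hne
    have h4 : a 0 ≤ ∑' k, a k := hsum.le_tsum 0 (fun j _ => ha0 j)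
    have h5 : (1 : ℝ) ≤ |((X.1 0 : ℕ) : ℝ) - ((Y.1 0 : ℕ) : ℝ)| := by
      have hz : ((X.1 0 : ℕ) : ℤ) - ((Y.1 0 : ℕ) : ℤ) ≠ 0 := by
        intro h
        apply hne
        apply Fin.ext
        omega
      have := Int.one_le_abs hz
      exact_mod_cast this
    have h6 : (1 : ℝ) / 10 ≤ a 0 := by
      simp only [ha]
      norm_num
      linarith
    have h7 : (9 : ℝ) / N * (1 / 10) ≤ 9 / N * ∑' k, a k :=
      mul_le_mul_of_nonneg_left (h6.trans h4) hc.le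
    linarith
  have ha00 : a 0 = 0 := by simp [ha, hS]
  have hshift : ∑' k, a k = ∑' k, a (k + 1) := by
    rw [hsum.tsum_eq_zero_add, ha00, zero_add]
  have hG : dCI (Gf f X) (Gf f Y) = (9 : ℝ) / N * ∑' k : ℕ, 10 * a (k + 1) := by
    unfold dCI
    have : (Gf f X).2 = (Gf f Y).2 := by simp [Gf, hE, hS]
    simp only [this, if_true, Finset.sum_const_zero, zero_add]
    congr 1
    refine tsum_congr fun k => ?_
    simp only [ha, Gf]
    rw [pow_succ _ (k + 1)]
    field_simp
  rw [hG, tsum_mul_left, ← hshift]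
  linarith
end

section
/- For a function f : {0,1}^N → {0,1}^N, the chaotic-iterations map G̃_f is chaotic according to Devaney on (X̃, d) if and only if the iteration graph Γ(f) is strongly connected. -/
open scoped BigOperators

/-- State after `n` steps of strategy `S` from `E`. -/
def runCI {N : ℕ} (f : BState N → BState N) (S : Strategy N) (E : BState N) : ℕ → BState N
  | 0 => E
  | n + 1 => Ff f (S n) (runCI f S E n)

/-- First `n` terms of `S`, then `T`. -/
def catCI {N : ℕ} (n : ℕ) (S T : Strategy N) : Strategy N :=
  fun k => if k < n then S k else T (k - n)

theorem iter_Gf {N : ℕ} (f : BState N → BState N) (S : Strategy N) (E : BState N) (n : ℕ) :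
    (Gf f)^[n] (S, E) = (fun k => S (k + n), runCI f S E n) := by
  induction n with
  | zero => rfl
  | succ n ih =>
    rw [Function.iterate_succ_apply', ih]
    simp only [Gf, runCI, Prod.mk.injEq]
    refine ⟨?_, by simp⟩
    funext k
    congr 1
    omega

theorem run_congr {N : ℕ} (f : BState N → BState N) (S T : Strategy N) (E : BState N) (n : ℕ)
    (h : ∀ k < n, S k = T k) : runCI f S E n = runCI f T E n := by
  induction n with
  | zero => rfl
  | succ n ih =>
    simp only [runCI]
    rw [ih (fun k hk => h k (by omega)), h n (by omega)]

theorem run_cat {N : ℕ} (f : BState N → BState N) (S T : Strategy N) (E : BState N) (n m : ℕ) :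
    runCI f (catCI n S T) E (n + m) = runCI f T (runCI f S E n) m := by
  induction m with
  | zero => exact run_congr f _ _ E n (fun k hk => by simp [catCI, hk])
  | succ m ih =>
    rw [← Nat.add_assoc]
    simp only [runCI]
    rw [ih]
    simp [catCI]

theorem reach_run {N : ℕ} (hN : 1 ≤ N) (f : BState N → BState N) (x y : BState N)
    (h : Relation.ReflTransGen (arc f) x y) : ∃ (m : ℕ) (P : Strategy N), runCI f P x m = y := by
  induction h with
  | refl => exact ⟨0, fun _ => ⟨0, hN⟩, rfl⟩
  | tail _ hbc ih =>
    obtain ⟨m, P, hP⟩ := ih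
    obtain ⟨i, hi, hf⟩ := hbc
    refine ⟨m + 1, catCI m P (fun _ => i), ?_⟩
    rw [run_cat, hP]
    simp only [runCI]
    rw [hf, hi]

theorem run_reach {N : ℕ} (f : BState N → BState N) (S : Strategy N) (x : BState N) (n : ℕ) :
    Relation.ReflTransGen (arc f) x (runCI f S x n) := by
  induction n with
  | zero => exact .refl
  | succ n ih =>
    simp only [runCI]
    generalize runCI f S x n = z at ih
    by_cases h : f z (S n) = z (S n)
    · have : Ff f (S n) z = z := by
        funext j
        by_cases hj : j = S n
        · subst hj; simp [Ff, h]
        · simp [Ff, hj]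
      rwa [this]
    · have : Ff f (S n) z = negComp (S n) z := by
        funext j
        by_cases hj : j = S n
        · subst hj
          simp only [Ff, negComp, if_true, Function.update_self]
          revert h
          cases f z (S n) <;> cases z (S n) <;> simp
        · simp [Ff, negComp, hj]
      exact ih.tail ⟨S n, this, this⟩

theorem dCI_lt_one {N : ℕ} (X Y : CISpace N) (h : dCI X Y < 1) : Y.2 = X.2 := by
  by_contra hne
  obtain ⟨j, hj⟩ := Function.ne_iff.mp hne
  have h1 : (1 : ℝ) ≤ ∑ k : Fin N, if X.2 k = Y.2 k then (0 : ℝ) else 1 := by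
    have := Finset.single_le_sum (s := Finset.univ)
      (f := fun k : Fin N => if X.2 k = Y.2 k then (0 : ℝ) else 1)
      (fun k _ => by positivity) (Finset.mem_univ j)
    simpa [Ne.symm hj] using this
  have h2 : 0 ≤ ((9 : ℝ) / N) *
      ∑' k : ℕ, |((X.1 k : ℕ) : ℝ) - ((Y.1 k : ℕ) : ℝ)| / 10 ^ (k + 1) :=
    mul_nonneg (by positivity) (tsum_nonneg fun k => by positivity)
  unfold dCI at h
  linarith

theorem dCI_le {N : ℕ} (hN : 1 ≤ N) (S T : Strategy N) (E : BState N) (n : ℕ)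
    (h : ∀ k < n, S k = T k) : dCI (S, E) (T, E) ≤ 18 * (1 / 5) ^ n := by
  have hN' : (0 : ℝ) < N := by exact_mod_cast hN
  have hb : ∀ k : ℕ, |((S k : ℕ) : ℝ) - ((T k : ℕ) : ℝ)| / 10 ^ (k + 1)
      ≤ (N * (1 / 5) ^ n) * (1 / 2 : ℝ) ^ k := by
    intro k
    by_cases hk : k < n
    · rw [h k hk]; simp only [sub_self, abs_zero, zero_div]; positivity
    · have h1 : |((S k : ℕ) : ℝ) - ((T k : ℕ) : ℝ)| ≤ N := by
        have a1 : ((S k : ℕ) : ℝ) ≤ N := by exact_mod_cast (S k).2.le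
        have a2 : ((T k : ℕ) : ℝ) ≤ N := by exact_mod_cast (T k).2.le
        have a3 : (0 : ℝ) ≤ ((S k : ℕ) : ℝ) := by positivity
        have a4 : (0 : ℝ) ≤ ((T k : ℕ) : ℝ) := by positivity
        rw [abs_le]; constructor <;> linarith
      have h2 : (1 / 5 : ℝ) ^ k ≤ (1 / 5) ^ n :=
        pow_le_pow_of_le_one (by norm_num) (by norm_num) (by omega)
      have h3 : (1 : ℝ) / 10 ^ (k + 1) ≤ (1 / 5) ^ k * (1 / 2) ^ k := by
        rw [← mul_pow, pow_succ]
        have : (1 / 5 * (1 / 2) : ℝ) ^ k = 1 / 10 ^ k := by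
          rw [← one_div_pow]; norm_num
        rw [this]
        apply one_div_le_one_div_of_le (by positivity)
        have : (0 : ℝ) < 10 ^ k := by positivity
        linarith
      calc _ = |((S k : ℕ) : ℝ) - ((T k : ℕ) : ℝ)| * (1 / 10 ^ (k + 1)) := by ring
        _ ≤ N * ((1 / 5) ^ k * (1 / 2) ^ k) := by gcongr
        _ ≤ N * ((1 / 5) ^ n * (1 / 2) ^ k) := by gcongr
        _ = _ := by ring
  have hs : Summable fun k : ℕ => (N * (1 / 5) ^ n) * (1 / 2 : ℝ) ^ k :=
    summable_geometric_two.mul_left _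
  have ht := (hs.of_nonneg_of_le (fun k => by positivity) hb).tsum_le_tsum hb hs
  rw [tsum_mul_left, tsum_geometric_two] at ht
  unfold dCI
  simp only [if_true, Finset.sum_const_zero, zero_add]
  calc _ ≤ ((9 : ℝ) / N) * (N * (1 / 5) ^ n * 2) := by gcongr
    _ = _ := by field_simp; norm_num

theorem exists_close {ε : ℝ} (hε : 0 < ε) : ∃ n : ℕ, 1 ≤ n ∧ 18 * (1 / 5 : ℝ) ^ n < ε := by
  obtain ⟨n, hn⟩ := exists_pow_lt_of_lt_one (show 0 < ε / 18 by positivity)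
    (show (1 / 5 : ℝ) < 1 by norm_num)
  refine ⟨n + 1, by omega, ?_⟩
  have : (1 / 5 : ℝ) ^ (n + 1) ≤ (1 / 5) ^ n :=
    pow_le_pow_of_le_one (by norm_num) (by norm_num) (by omega)
  linarith

/-- `G̃_f` is chaotic according to Devaney on `(𝒳̃, d)` if and only
if the iteration graph `Γ(f)` is strongly connected. -/
theorem devaney_iff_strongly_connected (N : ℕ) (hN : 1 ≤ N)
    (f : BState N → BState N) :
    DevaneyChaoticCI f ↔ GammaStronglyConnected f := by
  constructor
  · rintro ⟨-, htr⟩ x y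
    have hop : ∀ z : BState N, IsOpenCI {Z : CISpace N | Z.2 = z} := fun z X hX =>
      ⟨1, one_pos, fun Y hY => (dCI_lt_one X Y hY).trans hX⟩
    have S₀ : Strategy N := fun _ => ⟨0, hN⟩
    obtain ⟨k, -, W, ⟨⟨S, E⟩, hE, rfl⟩, hW⟩ :=
      htr _ _ (hop x) (hop y) ⟨(S₀, x), rfl⟩ ⟨(S₀, y), rfl⟩
    rw [iter_Gf] at hW
    have hE' : E = x := hE
    have hW' : runCI f S E k = y := hW
    rw [← hW', ← hE']
    exact run_reach f S E k
  · intro hc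
    refine ⟨?_, ?_⟩
    · rintro ⟨S, E⟩ ε hε
      obtain ⟨n, hn1, hn⟩ := exists_close hε
      obtain ⟨m, P, hP⟩ := reach_run hN f _ _ (hc (runCI f S E n) E)
      refine ⟨(fun k => catCI n S P (k % (n + m)), E), ⟨n + m, by omega, ?_⟩, ?_⟩
      · rw [iter_Gf]
        refine Prod.ext ?_ ?_
        · funext k
          simp
        · show runCI f _ E (n + m) = E
          rw [run_congr f _ (catCI n S P) E (n + m)
            (fun k hk => by simp only [Nat.mod_eq_of_lt hk]), run_cat, hP]
      · refine (dCI_le hN _ _ E n fun k hk => ?_).trans_lt hn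
        rw [Nat.mod_eq_of_lt (by omega)]
        simp [catCI, hk]
    · rintro U V hU - ⟨⟨S, E⟩, hx⟩ ⟨⟨T, E'⟩, hy⟩
      obtain ⟨ε, hε, hb⟩ := hU _ hx
      obtain ⟨n, hn1, hn⟩ := exists_close hε
      obtain ⟨m, P, hP⟩ := reach_run hN f _ _ (hc (runCI f S E n) E')
      refine ⟨n + m, by omega, (T, E'), ⟨(catCI n S (catCI m P T), E), ?_, ?_⟩, hy⟩
      · refine hb _ ((dCI_le hN _ _ E n fun k hk => ?_).trans_lt hn)
        simp [catCI, hk]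
      · rw [iter_Gf, run_cat]
        refine Prod.ext ?_ ?_
        · funext k
          have h1 : ¬ (k + (n + m) < n) := by omega
          have h2 : ¬ (k + (n + m) - n < m) := by omega
          have h3 : k + (n + m) - n - m = k := by omega
          simp only [catCI, h1, h2, h3, if_false]
        · show runCI f _ _ m = E'
          rw [← hP]
          exact run_congr f _ _ _ m (fun k hk => by simp [catCI, hk])
end
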